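/- arXiv:2305.09268 — 2 statements merged into one kernel-verified Lean document; each statement's English description precedes it below -/
import Mathlib

section
/- For every σ > 0, the function k_set(γ₁, γ₂) = exp(−λ(γ₁ Δ γ₂)/(2σ²)) is a symmetric positive definite kernel on the Lebesgue-measurable subsets of a compact set 𝒳 ⊂ ℝ^d: for every n ∈ ℕ, all real numbers α₁, …, α_n and all measurable sets γ₁, …, γ_n ⊆ 𝒳, one has ∑_{k=1}^n ∑_{l=1}^n α_k α_l exp(−λ(γ_k Δ γ_l)/(2σ²)) ≥ 0. -/
open MeasureTheory Set

open scoped Matrix in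
/-- The entrywise power of a positive semidefinite matrix is positive semidefinite. -/
lemma Matrix.PosSemidef.map_pow {ι : Type*} [Finite ι] {A : Matrix ι ι ℝ}
    (hA : A.PosSemidef) (m : ℕ) : (A.map (· ^ m)).PosSemidef := by
  induction m with
  | zero =>
    convert! Matrix.posSemidef_vecMulVec_self_star (fun _ : ι ↦ (1 : ℝ)) using 1
    ext i j
    simp [Matrix.vecMulVec_apply]
  | succ m ih =>
    have h : A.map (· ^ (m + 1)) = A.map (· ^ m) ⊙ A := by
      ext i j
      simp [pow_succ]
    exact h ▸ ih.hadamard hA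

lemma Matrix.PosSemidef.sum_sum_mul_nonneg {ι : Type*} [Fintype ι] {A : Matrix ι ι ℝ}
    (hA : A.PosSemidef) (x : ι → ℝ) : 0 ≤ ∑ k, ∑ l, x k * x l * A k l := by
  convert! hA.dotProduct_mulVec_nonneg x using 1
  simp only [dotProduct, Matrix.mulVec, Finset.mul_sum, Pi.star_apply, star_trivial]
  exact Finset.sum_congr rfl fun k _ ↦ Finset.sum_congr rfl fun l _ ↦ by ring

/-- The entrywise exponential of a positive semidefinite matrix has a nonnegative quadratic
form. -/
lemma Matrix.PosSemidef.sum_sum_mul_exp_nonneg {ι : Type*} [Fintype ι] {A : Matrix ι ι ℝ}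
    (hA : A.PosSemidef) (x : ι → ℝ) : 0 ≤ ∑ k, ∑ l, x k * x l * Real.exp (A k l) := by
  have h : HasSum (fun m : ℕ ↦ ∑ k, ∑ l, x k * x l * (A k l ^ m / m.factorial))
      (∑ k, ∑ l, x k * x l * Real.exp (A k l)) := by
    refine hasSum_sum fun k _ ↦ hasSum_sum fun l _ ↦ HasSum.mul_left _ ?_
    rw [Real.exp_eq_exp_ℝ]
    exact NormedSpace.expSeries_div_hasSum_exp (A k l)
  refine h.nonneg fun m ↦ ?_
  simp_rw [← mul_div_assoc, ← Finset.sum_div]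
  exact div_nonneg ((hA.map_pow m).sum_sum_mul_nonneg x) (Nat.cast_nonneg _)

lemma MeasureTheory.measureReal_symmDiff_eq_add_sub_inter {Ω : Type*} [MeasurableSpace Ω]
    (μ : Measure Ω) [IsFiniteMeasure μ] {s t : Set Ω} (hs : MeasurableSet s)
    (ht : MeasurableSet t) :
    μ.real (symmDiff s t) = μ.real s + μ.real t - 2 * μ.real (s ∩ t) := by
  have h₁ := measureReal_sdiff_add_inter (μ := μ) (s := s) ht
  have h₂ := measureReal_sdiff_add_inter (μ := μ) (s := t) hs
  rw [inter_comm] at h₂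
  rw [measureReal_symmDiff_eq hs ht]
  linarith

lemma MeasureTheory.sum_sum_mul_exp_neg_measureReal_symmDiff_nonneg {Ω ι : Type*}
    [MeasurableSpace Ω] [Fintype ι] (μ : Measure Ω) [IsFiniteMeasure μ] {c : ℝ} (hc : 0 ≤ c)
    {γ : ι → Set Ω} (hγ : ∀ i, MeasurableSet (γ i)) (α : ι → ℝ) :
    0 ≤ ∑ k, ∑ l, α k * α l * Real.exp (-(c * μ.real (symmDiff (γ k) (γ l)))) := by
  have hA := (posSemidef_matrix_measure_inter (μ := μ) hγ).smul (mul_nonneg zero_le_two hc)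
  convert! hA.sum_sum_mul_exp_nonneg (fun k ↦ α k * Real.exp (-(c * μ.real (γ k))))
    using 3 with k _ l _
  rw [measureReal_symmDiff_eq_add_sub_inter μ (hγ k) (hγ l),
    show -(c * (μ.real (γ k) + μ.real (γ l) - 2 * μ.real (γ k ∩ γ l)))
      = -(c * μ.real (γ k)) + -(c * μ.real (γ l)) + 2 * c * μ.real (γ k ∩ γ l) by ring,
    Real.exp_add, Real.exp_add]
  simp only [Matrix.smul_apply, Matrix.of_apply, smul_eq_mul]
  ring

/-- For every `σ > 0`, `k_set(γ₁, γ₂) = exp(−λ(γ₁ Δ γ₂)/(2σ²))` is a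
symmetric positive definite kernel on the Lebesgue-measurable subsets of a compact
`𝒳 ⊆ ℝ^d`: every quadratic form built from it is nonnegative, and it is symmetric. -/
theorem stmt_3 {d : ℕ} (𝒳 : Set (EuclideanSpace ℝ (Fin d))) (h𝒳 : IsCompact 𝒳)
    (σ : ℝ) (hσ : 0 < σ) :
    (∀ (γ₁ γ₂ : Set (EuclideanSpace ℝ (Fin d))), MeasurableSet γ₁ → MeasurableSet γ₂ →
      γ₁ ⊆ 𝒳 → γ₂ ⊆ 𝒳 →
      Real.exp (-((volume.restrict 𝒳) (symmDiff γ₁ γ₂)).toReal / (2 * σ ^ 2))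
        = Real.exp (-((volume.restrict 𝒳) (symmDiff γ₂ γ₁)).toReal / (2 * σ ^ 2)))
    ∧ ∀ (n : ℕ) (α : Fin n → ℝ) (γ : Fin n → Set (EuclideanSpace ℝ (Fin d))),
      (∀ i, MeasurableSet (γ i)) → (∀ i, γ i ⊆ 𝒳) →
      0 ≤ ∑ k : Fin n, ∑ l : Fin n,
        α k * α l *
          Real.exp (-((volume.restrict 𝒳) (symmDiff (γ k) (γ l))).toReal / (2 * σ ^ 2)) := by
  refine ⟨fun γ₁ γ₂ _ _ _ _ ↦ by rw [symmDiff_comm], fun n α γ hγ _ ↦ ?_⟩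
  have : IsFiniteMeasure (volume.restrict 𝒳) :=
    isFiniteMeasure_restrict.2 h𝒳.measure_lt_top.ne
  convert! sum_sum_mul_exp_neg_measureReal_symmDiff_nonneg (volume.restrict 𝒳)
    (c := (2 * σ ^ 2)⁻¹) (by positivity) hγ α using 5 with k _ l _
  rw [measureReal_def, neg_div, div_eq_inv_mul]
end

section
/- The kernel k_set is characteristic: let 𝒳 ⊂ ℝ^d be compact, σ > 0, and let F ⊆ L²(𝒳, λ) be the set of (classes of) functions f for which there exists a measurable γ ⊆ 𝒳 with f = 1_γ λ-a.e. If P and Q are Borel probability measures on L²(𝒳, λ) with P(F) = Q(F) = 1, and if for every f ∈ F one has ∫ exp(−‖f − g‖²_{L²}/(2σ²)) dP(g) = ∫ exp(−‖f − g‖²_{L²}/(2σ²)) dQ(g), then P = Q. (By Lemma 1, exp(−‖1_{γ₁} − 1_{γ₂}‖²_{L²}/(2σ²)) = k_set(γ₁, γ₂), so this asserts injectivity of the kernel mean embedding of distributions of random sets.) -/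
open MeasureTheory Set
open Filter Topology

/-- The classes of `{0, 1}`-valued functions form a closed subset of `L²`. -/
lemma isClosed_ae_zero_or_one {α : Type*} [MeasurableSpace α] (μ : Measure α) :
    IsClosed {f : Lp ℝ 2 μ | ∀ᵐ x ∂μ, f x = 0 ∨ f x = 1} := by
  refine IsSeqClosed.isClosed fun f g hf hfg => ?_
  obtain ⟨φ, -, hφ⟩ := (tendstoInMeasure_of_tendsto_Lp hfg).exists_seq_tendsto_ae
  filter_upwards [ae_all_iff.2 hf, hφ] with x hx hφx
  have : IsClosed ({0, 1} : Set ℝ) := (Set.toFinite _).isClosed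
  exact this.mem_of_tendsto hφx (Eventually.of_forall fun i => hx (φ i))

/-- Sets on which the parity of `⌊(n + 1) xᵢ⌋` is even. -/
def paritySet {ι : Type*} (i : ι) (n : ℕ) : Set (EuclideanSpace ℝ ι) :=
  {x | Even ⌊((n : ℝ) + 1) * x i⌋}

lemma measurableSet_paritySet {ι : Type*} [Fintype ι] (i : ι) (n : ℕ) :
    MeasurableSet (paritySet i n) := by
  have h : Measurable fun x : EuclideanSpace ℝ ι => ⌊((n : ℝ) + 1) * x i⌋ := by fun_prop
  exact h (MeasurableSet.of_discrete (s := {k : ℤ | Even k}))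

lemma vadd_mem_paritySet_iff {ι : Type*} [Fintype ι] [DecidableEq ι] (i : ι) (n : ℕ)
    (x : EuclideanSpace ℝ ι) :
    EuclideanSpace.single i (1 / ((n : ℝ) + 1)) + x ∈ paritySet i n ↔ x ∉ paritySet i n := by
  have hn : ((n : ℝ) + 1) ≠ 0 := by positivity
  simp only [paritySet, Set.mem_ofPred_eq, PiLp.add_apply, PiLp.single_apply, if_true]
  rw [mul_add, mul_one_div_cancel hn, add_comm, Int.floor_add_one, Int.even_add_one]

lemma tendsto_setIntegral_paritySet {ι : Type*} [Fintype ι] [DecidableEq ι] (i : ι)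
    {φ : EuclideanSpace ℝ ι → ℝ} (hφ : Integrable φ) :
    Tendsto (fun n => ∫ x in paritySet i n, φ x) atTop (𝓝 ((∫ x, φ x) / 2)) := by
  let v : ℕ → EuclideanSpace ℝ ι := fun n => EuclideanSpace.single i (1 / ((n : ℝ) + 1))
  have hv : Tendsto v atTop (𝓝 0) := by
    rw [tendsto_zero_iff_norm_tendsto_zero]
    have : ∀ n, ‖v n‖ = 1 / ((n : ℝ) + 1) := fun n => by
      simp only [v, PiLp.norm_single]
      exact abs_of_pos (by positivity)
    simp_rw [this]
    exact tendsto_one_div_add_atTop_nhds_zero_nat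
  have hp : MemLp φ 1 := memLp_one_iff_integrable.2 hφ
  have hint : ∀ n, Integrable (fun x => φ (v n + x)) := fun n => hφ.comp_add_left (v n)
  have hlim : Tendsto (fun n => ∫ x, ‖φ (v n + x) - φ x‖) atTop (𝓝 0) := by
    have : Fact ((1 : ENNReal) ≠ ⊤) := ⟨ENNReal.one_ne_top⟩
    have h1 : Tendsto (fun n => DomAddAct.mk (v n) +ᵥ hp.toLp φ) atTop
        (𝓝 (DomAddAct.mk (0 : EuclideanSpace ℝ ι) +ᵥ hp.toLp φ)) :=
      ((DomAddAct.continuous_mk.tendsto _).comp hv).vadd_const _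
    have h2 : DomAddAct.mk (0 : EuclideanSpace ℝ ι) +ᵥ hp.toLp φ = hp.toLp φ := by
      rw [DomAddAct.mk_zero, zero_vadd]
    rw [h2] at h1
    have h3 := tendsto_iff_norm_sub_tendsto_zero.1 h1
    refine h3.congr fun n => ?_
    rw [DomAddAct.mk_vadd_toLp, ← MemLp.toLp_sub, L1.norm_eq_integral_norm]
    refine integral_congr_ae ?_
    filter_upwards [MemLp.coeFn_toLp
      ((hp.comp_measurePreserving (measurePreserving_vadd (v n) volume)).sub hp)] with x hx
    exact congrArg norm hx
  have hdiff : ∀ n, (∫ x in paritySet i n, φ x) - (∫ x, φ x) / 2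
      = (∫ x in (paritySet i n)ᶜ, (φ (v n + x) - φ x)) / 2 := fun n => by
    have hm := measurableSet_paritySet i n
    have h1 : ∫ x in paritySet i n, φ x = ∫ x in (paritySet i n)ᶜ, φ (v n + x) := by
      rw [← integral_indicator hm, ← integral_indicator hm.compl,
        ← integral_add_left_eq_self _ (v n)]
      congr 1 with x
      by_cases hx : x ∈ paritySet i n
      · have := (vadd_mem_paritySet_iff i n x).not.2 (not_not.2 hx)
        rw [indicator_of_notMem this, indicator_of_notMem (by simpa using hx)]
      · have := (vadd_mem_paritySet_iff i n x).2 hx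
        rw [indicator_of_mem this, indicator_of_mem (by simpa using hx)]
    rw [integral_sub (hint n).integrableOn hφ.integrableOn, ← h1, ← integral_add_compl hm hφ]
    ring
  rw [tendsto_iff_norm_sub_tendsto_zero]
  refine squeeze_zero (fun _ => norm_nonneg _) (fun n => ?_) hlim
  rw [hdiff n, norm_div, Real.norm_ofNat]
  have h1 : ‖∫ x in (paritySet i n)ᶜ, (φ (v n + x) - φ x)‖ ≤ ∫ x, ‖φ (v n + x) - φ x‖ :=
    (norm_integral_le_integral_norm _).trans
      (setIntegral_le_integral ((hint n).sub hφ).norm (ae_of_all _ fun _ => norm_nonneg _))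
  have h2 := norm_nonneg (∫ x in (paritySet i n)ᶜ, (φ (v n + x) - φ x))
  linarith

/-- For `{0, 1}`-valued random elements, `∫ exp ⟨u, g⟩ dP(g)` is continuous in `u` along uniformly
bounded weakly convergent sequences. -/
lemma tendsto_integral_exp_pairing {α : Type*} [MeasurableSpace α] {μ : Measure α}
    [IsFiniteMeasure μ] [MeasurableSpace (Lp ℝ 2 μ)] [BorelSpace (Lp ℝ 2 μ)]
    (P : Measure (Lp ℝ 2 μ)) [IsFiniteMeasure P]
    (hP : ∀ᵐ g ∂P, ∀ᵐ x ∂μ, g x = 0 ∨ g x = 1)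
    {u : ℕ → α → ℝ} {w : α → ℝ} {C : ℝ} (hu : ∀ n, Measurable (u n))
    (hC : ∀ n x, |u n x| ≤ C)
    (h : ∀ g : Lp ℝ 2 μ, Tendsto (fun n => ∫ x, u n x * g x ∂μ) atTop (𝓝 (∫ x, w x * g x ∂μ))) :
    Tendsto (fun n => ∫ g, Real.exp (∫ x, u n x * g x ∂μ) ∂P) atTop
      (𝓝 (∫ g, Real.exp (∫ x, w x * g x ∂μ) ∂P)) := by
  refine tendsto_integral_of_dominated_convergence (fun _ => Real.exp (C * μ.real univ))
    (fun n => ?_) (integrable_const _) (fun n => ?_) (ae_of_all _ fun g => ?_)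
  · have hL : MemLp (u n) 2 μ := MemLp.of_bound (hu n).aestronglyMeasurable C
      (ae_of_all _ fun x => hC n x)
    have : ∀ g : Lp ℝ 2 μ, ∫ x, u n x * g x ∂μ = inner ℝ (hL.toLp (u n)) g := fun g => by
      rw [L2.inner_def]
      refine integral_congr_ae ?_
      filter_upwards [hL.coeFn_toLp] with x hx
      simp [hx, mul_comm]
    simp_rw [this]
    exact (Continuous.measurable (by fun_prop)).aestronglyMeasurable
  · filter_upwards [hP] with g hg
    rw [Real.norm_of_nonneg (Real.exp_pos _).le, Real.exp_le_exp]
    refine (le_abs_self _).trans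
      (norm_integral_le_of_norm_le_const (μ := μ) (f := fun x => u n x * g x) (C := C) ?_)
    filter_upwards [hg] with x hx
    have := hC n x
    have h0 := (abs_nonneg _).trans this
    rcases hx with hx | hx <;> simp [hx, this, h0]
  · exact (Real.continuous_exp.tendsto _).comp (h g)

lemma integrable_bounded_mul {α : Type*} [MeasurableSpace α] {μ : Measure α}
    [IsFiniteMeasure μ] {u : α → ℝ} {C : ℝ} (hu : Measurable u) (hC : ∀ x, |u x| ≤ C)
    (g : Lp ℝ 2 μ) : Integrable (fun x => u x * g x) μ :=
  ((Lp.memLp g).integrable one_le_two).bdd_mul hu.aestronglyMeasurable (ae_of_all _ hC)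

section Extension

variable {α : Type*} [MeasurableSpace α] {μ : Measure α} [IsFiniteMeasure μ]
  [MeasurableSpace (Lp ℝ 2 μ)] [BorelSpace (Lp ℝ 2 μ)]
  {P Q : Measure (Lp ℝ 2 μ)} [IsProbabilityMeasure P] [IsProbabilityMeasure Q]

lemma abs_mul_two_mul_sub_one_le {c t : ℝ} (h0 : 0 ≤ t) (h1 : t ≤ 1) :
    |c * (2 * t - 1)| ≤ |c| := by
  rw [abs_mul]
  exact mul_le_of_le_one_right (abs_nonneg _) (abs_le.2 ⟨by linarith, by linarith⟩)

/-- Averaging along the sets `R n` halves the mesh of the admissible dyadic values. -/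
lemma integral_exp_pairing_eq_of_dyadic
    (hP : ∀ᵐ g ∂P, ∀ᵐ x ∂μ, g x = 0 ∨ g x = 1)
    (hQ : ∀ᵐ g ∂Q, ∀ᵐ x ∂μ, g x = 0 ∨ g x = 1)
    {R : ℕ → Set α} (hR : ∀ n, MeasurableSet (R n))
    (hlim : ∀ φ : α → ℝ, Integrable φ μ →
      Tendsto (fun n => ∫ x in R n, φ x ∂μ) atTop (𝓝 ((∫ x, φ x ∂μ) / 2)))
    {c : ℝ}
    (hbase : ∀ γ : Set α, MeasurableSet γ →
      ∫ g, Real.exp (∫ x, c * (2 * γ.indicator (fun _ => 1) x - 1) * g x ∂μ) ∂P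
        = ∫ g, Real.exp (∫ x, c * (2 * γ.indicator (fun _ => 1) x - 1) * g x ∂μ) ∂Q)
    (m : ℕ) (j : α → ℕ) (hj : Measurable j)
    (hjm : ∀ x, j x ≤ 2 ^ m) :
    ∫ g, Real.exp (∫ x, c * (2 * (j x / 2 ^ m) - 1) * g x ∂μ) ∂P
      = ∫ g, Real.exp (∫ x, c * (2 * (j x / 2 ^ m) - 1) * g x ∂μ) ∂Q := by
  have cast_meas : ∀ (k : α → ℕ) (p : ℕ), Measurable k →
      Measurable fun x => c * (2 * ((k x : ℝ) / 2 ^ p) - 1) := fun k p hk => by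
    have : Measurable fun x => (k x : ℝ) := measurable_from_top.comp hk
    fun_prop
  have bound : ∀ (k : α → ℕ) (p : ℕ), (∀ x, k x ≤ 2 ^ p) →
      ∀ x, |c * (2 * ((k x : ℝ) / 2 ^ p) - 1)| ≤ |c| := fun k p hk x => by
    refine abs_mul_two_mul_sub_one_le (by positivity) ?_
    rw [div_le_one (by positivity)]
    exact_mod_cast hk x
  induction m generalizing j with
  | zero =>
    have hγ : MeasurableSet (j ⁻¹' {1}) := hj (measurableSet_singleton 1)
    have : ∀ x, (j x : ℝ) / 2 ^ 0 = (j ⁻¹' {1}).indicator (fun _ => 1) x := fun x => by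
      have := hjm x
      by_cases h : j x = 1
      · simp [h]
      · have h0 : j x = 0 := by
          rw [pow_zero] at this
          omega
        simp [h0]
    simp_rw [this]
    exact hbase _ hγ
  | succ m ih =>
    classical
    let a : α → ℕ := fun x => (j x + 1) / 2
    let b : α → ℕ := fun x => j x / 2
    let w : ℕ → α → ℕ := fun n => (R n).piecewise a b
    have ha : Measurable a :=
      (measurable_from_top (f := fun k : ℕ => (k + 1) / 2)).comp hj
    have hb : Measurable b :=
      (measurable_from_top (f := fun k : ℕ => k / 2)).comp hj
    have hw : ∀ n, Measurable (w n) := fun n => ha.piecewise (hR n) hb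
    have ham : ∀ x, a x ≤ 2 ^ m := fun x => by
      have := hjm x
      simp only [a]
      omega
    have hbm : ∀ x, b x ≤ 2 ^ m := fun x => by
      have := hjm x
      simp only [b]
      omega
    have hwm : ∀ n x, w n x ≤ 2 ^ m := fun n x => by
      by_cases h : x ∈ R n <;> simp [w, h, ham, hbm]
    have hconv : ∀ g : Lp ℝ 2 μ,
        Tendsto (fun n => ∫ x, c * (2 * ((w n x : ℝ) / 2 ^ m) - 1) * g x ∂μ) atTop
          (𝓝 (∫ x, c * (2 * ((j x : ℝ) / 2 ^ (m + 1)) - 1) * g x ∂μ)) := fun g => by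
      have hA := integrable_bounded_mul (cast_meas a m ha) (bound a m ham) g
      have hB := integrable_bounded_mul (cast_meas b m hb) (bound b m hbm) g
      have h1 : ∀ n, ∫ x, c * (2 * ((w n x : ℝ) / 2 ^ m) - 1) * g x ∂μ
          = (∫ x in R n, c * (2 * ((a x : ℝ) / 2 ^ m) - 1) * g x ∂μ)
            + ((∫ x, c * (2 * ((b x : ℝ) / 2 ^ m) - 1) * g x ∂μ)
              - ∫ x in R n, c * (2 * ((b x : ℝ) / 2 ^ m) - 1) * g x ∂μ) := fun n => by
        rw [← setIntegral_compl (hR n) hB,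
          ← integral_add_compl (hR n) (integrable_bounded_mul (cast_meas _ m (hw n))
            (bound _ m (hwm n)) g)]
        congr 1
        · refine setIntegral_congr_fun (hR n) fun x hx => ?_
          simp [w, hx]
        · refine setIntegral_congr_fun (hR n).compl fun x hx => ?_
          have hx' : x ∉ R n := hx
          simp [w, hx']
      simp_rw [h1]
      have h2 : ∫ x, c * (2 * ((j x : ℝ) / 2 ^ (m + 1)) - 1) * g x ∂μ
          = (∫ x, c * (2 * ((a x : ℝ) / 2 ^ m) - 1) * g x ∂μ) / 2
            + ((∫ x, c * (2 * ((b x : ℝ) / 2 ^ m) - 1) * g x ∂μ)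
              - (∫ x, c * (2 * ((b x : ℝ) / 2 ^ m) - 1) * g x ∂μ) / 2) := by
        rw [sub_half, ← add_div, ← integral_add hA hB, ← integral_div]
        refine integral_congr_ae (ae_of_all _ fun x => ?_)
        have hab : (j x : ℝ) = a x + b x := by
          have : j x = a x + b x := by
            simp only [a, b]
            omega
          exact_mod_cast this
        simp only [hab, pow_succ]
        field_simp
        ring
      rw [h2]
      exact (hlim _ hA).add (tendsto_const_nhds.sub (hlim _ hB))
    have hPl := tendsto_integral_exp_pairing P hP (fun n => cast_meas _ m (hw n))
      (fun n => bound _ m (hwm n)) hconv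
    have hQl := tendsto_integral_exp_pairing Q hQ (fun n => cast_meas _ m (hw n))
      (fun n => bound _ m (hwm n)) hconv
    exact tendsto_nhds_unique hPl (hQl.congr fun n => (ih _ (hw n) (hwm n)).symm)

lemma integral_exp_pairing_eq
    (hP : ∀ᵐ g ∂P, ∀ᵐ x ∂μ, g x = 0 ∨ g x = 1)
    (hQ : ∀ᵐ g ∂Q, ∀ᵐ x ∂μ, g x = 0 ∨ g x = 1)
    {R : ℕ → Set α} (hR : ∀ n, MeasurableSet (R n))
    (hlim : ∀ φ : α → ℝ, Integrable φ μ →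
      Tendsto (fun n => ∫ x in R n, φ x ∂μ) atTop (𝓝 ((∫ x, φ x ∂μ) / 2)))
    {c : ℝ}
    (hbase : ∀ γ : Set α, MeasurableSet γ →
      ∫ g, Real.exp (∫ x, c * (2 * γ.indicator (fun _ => 1) x - 1) * g x ∂μ) ∂P
        = ∫ g, Real.exp (∫ x, c * (2 * γ.indicator (fun _ => 1) x - 1) * g x ∂μ) ∂Q)
    (θ : α → ℝ) (hθ : Measurable θ) (h0 : ∀ x, 0 ≤ θ x) (h1 : ∀ x, θ x ≤ 1) :
    ∫ g, Real.exp (∫ x, c * (2 * θ x - 1) * g x ∂μ) ∂P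
      = ∫ g, Real.exp (∫ x, c * (2 * θ x - 1) * g x ∂μ) ∂Q := by
  let j : ℕ → α → ℕ := fun m x => ⌊2 ^ m * θ x⌋₊
  have hj : ∀ m, Measurable (j m) := fun m => by
    have : Measurable fun x => (2 : ℝ) ^ m * θ x := by fun_prop
    exact Nat.measurable_floor.comp this
  have hjm : ∀ m x, j m x ≤ 2 ^ m := fun m x => by
    refine Nat.floor_le_of_le ?_
    push_cast
    exact mul_le_of_le_one_right (by positivity) (h1 x)
  have hmeas : ∀ m, Measurable fun x => c * (2 * ((j m x : ℝ) / 2 ^ m) - 1) := fun m => by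
    have : Measurable fun x => (j m x : ℝ) := measurable_from_top.comp (hj m)
    fun_prop
  have hbound : ∀ m x, |c * (2 * ((j m x : ℝ) / 2 ^ m) - 1)| ≤ |c| := fun m x => by
    refine abs_mul_two_mul_sub_one_le (by positivity) ?_
    rw [div_le_one (by positivity)]
    exact_mod_cast hjm m x
  have hpt : ∀ x, Tendsto (fun m => (j m x : ℝ) / 2 ^ m) atTop (𝓝 (θ x)) := fun x => by
    have h2 : Tendsto (fun m : ℕ => (2 : ℝ) ^ m) atTop atTop :=
      tendsto_pow_atTop_atTop_of_one_lt one_lt_two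
    refine ((tendsto_nat_floor_mul_div_atTop (h0 x)).comp h2).congr fun m => ?_
    simp [j, mul_comm]
  have hconv : ∀ g : Lp ℝ 2 μ,
      Tendsto (fun m => ∫ x, c * (2 * ((j m x : ℝ) / 2 ^ m) - 1) * g x ∂μ) atTop
        (𝓝 (∫ x, c * (2 * θ x - 1) * g x ∂μ)) := fun g => by
    refine tendsto_integral_of_dominated_convergence (fun x => |c| * |g x|)
      (fun m => (integrable_bounded_mul (hmeas m) (hbound m) g).aestronglyMeasurable)
      (((Lp.memLp g).integrable one_le_two).abs.const_mul _) (fun m => ae_of_all _ fun x => ?_)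
      (ae_of_all _ fun x => ?_)
    · rw [Real.norm_eq_abs, abs_mul]
      exact mul_le_mul_of_nonneg_right (hbound m x) (abs_nonneg _)
    · exact ((((hpt x).const_mul 2).sub_const 1).const_mul c).mul_const _
  have hPl := tendsto_integral_exp_pairing P hP hmeas hbound hconv
  have hQl := tendsto_integral_exp_pairing Q hQ hmeas hbound hconv
  exact tendsto_nhds_unique hPl (hQl.congr fun m =>
    (integral_exp_pairing_eq_of_dyadic hP hQ hR hlim hbase m _ (hj m) (hjm m)).symm)

open ProbabilityTheory in
lemma charFun_eq_of_bounded
    (hP : ∀ᵐ g ∂P, ∀ᵐ x ∂μ, g x = 0 ∨ g x = 1)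
    (hQ : ∀ᵐ g ∂Q, ∀ᵐ x ∂μ, g x = 0 ∨ g x = 1)
    {R : ℕ → Set α} (hR : ∀ n, MeasurableSet (R n))
    (hlim : ∀ φ : α → ℝ, Integrable φ μ →
      Tendsto (fun n => ∫ x in R n, φ x ∂μ) atTop (𝓝 ((∫ x, φ x ∂μ) / 2)))
    {c : ℝ} (hc : 0 < c)
    (hbase : ∀ γ : Set α, MeasurableSet γ →
      ∫ g, Real.exp (∫ x, c * (2 * γ.indicator (fun _ => 1) x - 1) * g x ∂μ) ∂P
        = ∫ g, Real.exp (∫ x, c * (2 * γ.indicator (fun _ => 1) x - 1) * g x ∂μ) ∂Q)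
    (h : Lp ℝ 2 μ) (u : α → ℝ) (hu : Measurable u) (C : ℝ) (hC : ∀ x, |u x| ≤ C)
    (hhu : h =ᵐ[μ] u) : charFun P h = charFun Q h := by
  let X : Lp ℝ 2 μ → ℝ := fun g => inner ℝ g h
  have hX : ∀ g, X g = ∫ x, u x * g x ∂μ := fun g => by
    simp only [X, L2.inner_def]
    refine integral_congr_ae ?_
    filter_upwards [hhu] with x hx
    simp [hx]
  have hXm : Measurable X := Continuous.measurable (by fun_prop)
  have hXb : ∀ g : Lp ℝ 2 μ, (∀ᵐ x ∂μ, g x = 0 ∨ g x = 1) →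
      X g ∈ Icc (-(C * μ.real univ)) (C * μ.real univ) := fun g hg => by
    rw [hX, mem_Icc, ← abs_le]
    refine norm_integral_le_of_norm_le_const (μ := μ) (f := fun x => u x * g x) (C := C) ?_
    filter_upwards [hg] with x hx
    have := hC x
    have h0 := (abs_nonneg _).trans this
    rcases hx with hx | hx <;> simp [hx, this, h0]
  have hPu : integrableExpSet X P = univ := eq_univ_of_forall fun t =>
    integrable_exp_mul_of_mem_Icc hXm.aemeasurable (hP.mono hXb)
  have hQu : integrableExpSet X Q = univ := eq_univ_of_forall fun t =>
    integrable_exp_mul_of_mem_Icc hXm.aemeasurable (hQ.mono hXb)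
  have hnear : mgf X P =ᶠ[𝓝 0] mgf X Q := by
    have hlt : ∀ᶠ t : ℝ in 𝓝 0, |t| * C < c := by
      have : Tendsto (fun t : ℝ => |t| * C) (𝓝 0) (𝓝 (|0| * C)) :=
        Continuous.tendsto (by fun_prop) 0
      rw [abs_zero, zero_mul] at this
      exact this.eventually_lt_const hc
    filter_upwards [hlt] with t ht
    have hb : ∀ x, |t * u x / c| ≤ 1 := fun x => by
      rw [abs_div, abs_of_pos hc, div_le_one hc, abs_mul]
      exact (mul_le_mul_of_nonneg_left (hC x) (abs_nonneg t)).trans ht.le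
    have key := integral_exp_pairing_eq hP hQ hR hlim hbase (fun x => (1 + t * u x / c) / 2)
      (by fun_prop) (fun x => by have := (abs_le.1 (hb x)).1; linarith)
      (fun x => by have := (abs_le.1 (hb x)).2; linarith)
    have hrw : ∀ g : Lp ℝ 2 μ,
        ∫ x, c * (2 * ((1 + t * u x / c) / 2) - 1) * g x ∂μ = t * X g := fun g => by
      rw [hX, ← integral_const_mul]
      refine integral_congr_ae (ae_of_all _ fun x => ?_)
      field_simp
      ring
    simp_rw [hrw] at key
    exact key
  have hmgf : mgf X P = mgf X Q := by
    have hPa : AnalyticOnNhd ℝ (mgf X P) univ := by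
      simpa [hPu] using analyticOnNhd_mgf (X := X) (μ := P)
    have hQa : AnalyticOnNhd ℝ (mgf X Q) univ := by
      simpa [hQu] using analyticOnNhd_mgf (X := X) (μ := Q)
    exact hPa.eq_of_eventuallyEq hQa hnear
  have := eqOn_complexMGF_of_mgf hmgf (x := Complex.I) (by simp [hPu])
  simp only [complexMGF] at this
  simp only [charFun_apply, mul_comm _ Complex.I]
  exact this

/-- Two laws of `{0, 1}`-valued random functions on a non-atomic space agree as soon as their
Laplace transforms agree on all functions `c (2 · 1_γ - 1)`. -/
lemma measure_eq_of_integral_exp_pairing_eq [MeasurableSpace.CountablyGenerated α]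
    (hP : ∀ᵐ g ∂P, ∀ᵐ x ∂μ, g x = 0 ∨ g x = 1)
    (hQ : ∀ᵐ g ∂Q, ∀ᵐ x ∂μ, g x = 0 ∨ g x = 1)
    {R : ℕ → Set α} (hR : ∀ n, MeasurableSet (R n))
    (hlim : ∀ φ : α → ℝ, Integrable φ μ →
      Tendsto (fun n => ∫ x in R n, φ x ∂μ) atTop (𝓝 ((∫ x, φ x ∂μ) / 2)))
    {c : ℝ} (hc : 0 < c)
    (hbase : ∀ γ : Set α, MeasurableSet γ →
      ∫ g, Real.exp (∫ x, c * (2 * γ.indicator (fun _ => 1) x - 1) * g x ∂μ) ∂P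
        = ∫ g, Real.exp (∫ x, c * (2 * γ.indicator (fun _ => 1) x - 1) * g x ∂μ) ∂Q) :
    P = Q := by
  have : Fact ((2 : ENNReal) ≠ ⊤) := ⟨ENNReal.ofNat_ne_top⟩
  refine Measure.ext_of_charFun ?_
  refine (Lp.simpleFunc.denseRange (E := ℝ) (μ := μ) (p := 2) ENNReal.ofNat_ne_top).equalizer
    continuous_charFun continuous_charFun (funext fun s => ?_)
  obtain ⟨C, hC⟩ := (Lp.simpleFunc.toSimpleFunc s).exists_forall_norm_le
  exact charFun_eq_of_bounded hP hQ hR hlim hc hbase _ _ (SimpleFunc.measurable _) C hC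
    (Lp.simpleFunc.toSimpleFunc_eq_toFun s).symm

end Extension

/-- On a space where measurable functions are constant, the law of a `{0, 1}`-valued random
element is determined by one value of its kernel mean embedding. -/
lemma measure_eq_of_ae_eq_zero_or_eq {H : Type*} [NormedAddCommGroup H] [InnerProductSpace ℝ H]
    [CompleteSpace H] [SecondCountableTopology H] [MeasurableSpace H] [BorelSpace H]
    (P Q : Measure H) [IsProbabilityMeasure P] [IsProbabilityMeasure Q] (e : H)
    (hP : ∀ᵐ g ∂P, g = 0 ∨ g = e) (hQ : ∀ᵐ g ∂Q, g = 0 ∨ g = e) {σ : ℝ} (hσ : 0 < σ)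
    (h : ∫ g, Real.exp (-‖0 - g‖ ^ 2 / (2 * σ ^ 2)) ∂P
      = ∫ g, Real.exp (-‖0 - g‖ ^ 2 / (2 * σ ^ 2)) ∂Q) : P = Q := by
  refine Measure.ext_of_charFun (funext fun t => ?_)
  let k : H → ℝ := fun g => Real.exp (-‖0 - g‖ ^ 2 / (2 * σ ^ 2))
  have hk1 : ∀ g, ‖k g‖ ≤ 1 := fun g => by
    rw [Real.norm_of_nonneg (Real.exp_pos _).le, Real.exp_le_one_iff, neg_div]
    exact neg_nonpos.2 (by positivity)
  have hkm : Continuous k := by fun_prop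
  obtain ⟨a, b, h0, he⟩ : ∃ a b : ℂ,
      Complex.exp ((inner ℝ (0 : H) t : ℝ) * Complex.I) = a + b * k 0 ∧
      Complex.exp ((inner ℝ e t : ℝ) * Complex.I) = a + b * k e := by
    by_cases hz : e = 0
    · exact ⟨Complex.exp ((inner ℝ (0 : H) t : ℝ) * Complex.I), 0, by simp, by simp [hz]⟩
    · have hne : (k e : ℂ) - 1 ≠ 0 := by
        have : k e < 1 := by
          rw [Real.exp_lt_one_iff, zero_sub, norm_neg, neg_div]
          have := norm_pos_iff.2 hz
          exact neg_neg_of_pos (by positivity)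
        exact_mod_cast (sub_neg.2 this).ne
      refine ⟨1 - (Complex.exp ((inner ℝ e t : ℝ) * Complex.I) - 1) / (k e - 1),
        (Complex.exp ((inner ℝ e t : ℝ) * Complex.I) - 1) / (k e - 1), by simp [k], ?_⟩
      field_simp
      ring
  have key : ∀ (M : Measure H) [IsProbabilityMeasure M], (∀ᵐ g ∂M, g = 0 ∨ g = e) →
      charFun M t = a + b * ((∫ g, k g ∂M : ℝ) : ℂ) := fun M _ hM => by
    have hki : Integrable (fun g => (k g : ℂ)) M :=
      (Integrable.of_bound hkm.aestronglyMeasurable 1 (ae_of_all _ hk1)).ofReal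
    have : charFun M t = ∫ g, (a + b * (k g : ℂ)) ∂M := by
      rw [charFun_apply]
      refine integral_congr_ae ?_
      filter_upwards [hM] with g hg
      rcases hg with rfl | rfl
      exacts [h0, he]
    rw [this, integral_add (integrable_const _) (hki.const_mul b), integral_const_mul,
      integral_complex_ofReal]
    simp
  rw [key P hP, key Q hQ, h]

/-- The kernel `k_set` is characteristic: if two Borel probability measures
`P, Q` on `L²(𝒳, λ)` are concentrated on the set `F` of (classes of) indicator functions
of measurable subsets of `𝒳` and have the same kernel mean embedding, i.e.
`∫ exp(−‖f − g‖²/(2σ²)) dP(g) = ∫ exp(−‖f − g‖²/(2σ²)) dQ(g)` for every `f ∈ F`,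
then `P = Q`. -/
theorem stmt_7 {d : ℕ} (𝒳 : Set (EuclideanSpace ℝ (Fin d))) (h𝒳 : IsCompact 𝒳)
    (σ : ℝ) (hσ : 0 < σ)
    [MeasurableSpace (Lp ℝ 2 (volume.restrict 𝒳))]
    [BorelSpace (Lp ℝ 2 (volume.restrict 𝒳))]
    (F : Set (Lp ℝ 2 (volume.restrict 𝒳)))
    (hF : F = {f : Lp ℝ 2 (volume.restrict 𝒳) |
      ∃ γ : Set (EuclideanSpace ℝ (Fin d)), MeasurableSet γ ∧ γ ⊆ 𝒳 ∧
        (f : EuclideanSpace ℝ (Fin d) → ℝ)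
          =ᵐ[volume.restrict 𝒳] γ.indicator (fun _ => (1 : ℝ))})
    (P Q : Measure (Lp ℝ 2 (volume.restrict 𝒳)))
    [IsProbabilityMeasure P] [IsProbabilityMeasure Q]
    (hP : P F = 1) (hQ : Q F = 1)
    (hembed : ∀ f ∈ F,
      ∫ g, Real.exp (-‖f - g‖ ^ 2 / (2 * σ ^ 2)) ∂P
        = ∫ g, Real.exp (-‖f - g‖ ^ 2 / (2 * σ ^ 2)) ∂Q) :
    P = Q := by
  have : Fact ((2 : ENNReal) ≠ ⊤) := ⟨ENNReal.ofNat_ne_top⟩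
  have hXm : MeasurableSet 𝒳 := h𝒳.measurableSet
  have : IsFiniteMeasure ((volume : Measure (EuclideanSpace ℝ (Fin d))).restrict 𝒳) :=
    isFiniteMeasure_restrict.2 h𝒳.measure_lt_top.ne
  have hFeq : F = {f : Lp ℝ 2 (volume.restrict 𝒳) |
      ∀ᵐ x ∂volume.restrict 𝒳, f x = 0 ∨ f x = 1} := by
    rw [hF]
    ext f
    constructor
    · rintro ⟨γ, -, -, hfγ⟩
      filter_upwards [hfγ] with x hx
      rw [hx]
      by_cases h : x ∈ γ <;> simp [h]
    · intro hf
      refine ⟨𝒳 ∩ f ⁻¹' {1}, hXm.inter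
        ((Lp.stronglyMeasurable f).measurable (measurableSet_singleton 1)),
        inter_subset_left, ?_⟩
      filter_upwards [hf, ae_restrict_mem hXm] with x hx hxX
      rcases hx with hx | hx <;> simp [hx, hxX, indicator]
  have hFm : MeasurableSet F := by
    rw [hFeq]
    exact (isClosed_ae_zero_or_one (volume.restrict 𝒳)).measurableSet
  have hPF : ∀ᵐ g ∂P, ∀ᵐ x ∂volume.restrict 𝒳, g x = 0 ∨ g x = 1 := by
    have := (prob_compl_eq_zero_iff hFm).2 hP
    rwa [hFeq] at this
  have hQF : ∀ᵐ g ∂Q, ∀ᵐ x ∂volume.restrict 𝒳, g x = 0 ∨ g x = 1 := by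
    have := (prob_compl_eq_zero_iff hFm).2 hQ
    rwa [hFeq] at this
  rcases Nat.eq_zero_or_pos d with rfl | hd
  · let e : Lp ℝ 2 (volume.restrict 𝒳) := Lp.const 2 (volume.restrict 𝒳) 1
    have he : ∀ g : Lp ℝ 2 (volume.restrict 𝒳),
        (∀ᵐ x ∂volume.restrict 𝒳, g x = 0 ∨ g x = 1) → g = 0 ∨ g = e := fun g hg => by
      by_cases h0 : g 0 = 1
      · right
        refine Lp.ext ?_
        filter_upwards [Lp.coeFn_const (p := 2) (μ := volume.restrict 𝒳) (1 : ℝ)] with x hx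
        rw [hx, Subsingleton.elim x 0, h0]
        rfl
      · left
        refine Lp.ext ?_
        filter_upwards [Lp.coeFn_zero ℝ 2 (volume.restrict 𝒳), hg] with x hx hgx
        rw [hx]
        refine hgx.resolve_right ?_
        rwa [Subsingleton.elim x 0]
    refine measure_eq_of_ae_eq_zero_or_eq P Q e (hPF.mono he) (hQF.mono he) hσ (hembed 0 ?_)
    rw [hFeq]
    filter_upwards [Lp.coeFn_zero ℝ 2 (volume.restrict 𝒳)] with x hx
    exact Or.inl hx
  · let i : Fin d := ⟨0, hd⟩
    refine measure_eq_of_integral_exp_pairing_eq hPF hQF (measurableSet_paritySet i)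
      (fun φ hφ => ?_) (c := 1 / (2 * σ ^ 2)) (by positivity) fun γ hγ => ?_
    · have h := tendsto_setIntegral_paritySet i ((integrable_indicator_iff hXm).2 hφ)
      rw [integral_indicator hXm] at h
      refine h.congr fun n => ?_
      rw [setIntegral_indicator hXm, Measure.restrict_restrict (measurableSet_paritySet i n)]
    · have hm : MemLp (γ.indicator fun _ => (1 : ℝ)) 2 (volume.restrict 𝒳) :=
        (memLp_const (1 : ℝ)).indicator hγ
      let f : Lp ℝ 2 (volume.restrict 𝒳) := hm.toLp _
      have hfγ : f =ᵐ[volume.restrict 𝒳] γ.indicator fun _ => (1 : ℝ) := hm.coeFn_toLp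
      have hfF : f ∈ F := by
        rw [hFeq]
        filter_upwards [hfγ] with x hx
        rw [hx]
        by_cases h : x ∈ γ <;> simp [h]
      have hexp : ∀ g : Lp ℝ 2 (volume.restrict 𝒳), (∀ᵐ x ∂volume.restrict 𝒳, g x = 0 ∨ g x = 1) →
          Real.exp (∫ x, 1 / (2 * σ ^ 2) * (2 * γ.indicator (fun _ => 1) x - 1) * g x
              ∂volume.restrict 𝒳)
            = Real.exp (‖f‖ ^ 2 / (2 * σ ^ 2)) * Real.exp (-‖f - g‖ ^ 2 / (2 * σ ^ 2)) :=
          fun g hg => by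
        have hsq : ‖g‖ ^ 2 = ∫ x, g x ∂volume.restrict 𝒳 := by
          rw [← real_inner_self_eq_norm_sq, L2.inner_def]
          refine integral_congr_ae ?_
          filter_upwards [hg] with x hx
          rcases hx with hx | hx <;> simp [hx]
        have hfg : inner ℝ f g = ∫ x, γ.indicator (fun _ => 1) x * g x ∂volume.restrict 𝒳 := by
          rw [L2.inner_def]
          refine integral_congr_ae ?_
          filter_upwards [hfγ] with x hx
          simp [hx, mul_comm]
        have hγi : Integrable (fun x => γ.indicator (fun _ => 1) x * g x) (volume.restrict 𝒳) := by
          refine integrable_bounded_mul (C := 1) (measurable_const.indicator hγ) (fun x => ?_) g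
          by_cases h : x ∈ γ <;> simp [h]
        have hlin : ∫ x, 1 / (2 * σ ^ 2) * (2 * γ.indicator (fun _ => 1) x - 1) * g x
              ∂volume.restrict 𝒳
            = 1 / (2 * σ ^ 2) * (2 * inner ℝ f g - ‖g‖ ^ 2) := by
          rw [hfg, hsq, ← integral_const_mul, ← integral_sub (hγi.const_mul 2)
            ((Lp.memLp g).integrable one_le_two), ← integral_const_mul]
          refine integral_congr_ae (ae_of_all _ fun x => ?_)
          ring
        rw [← Real.exp_add, hlin, norm_sub_sq_real]
        congr 1
        ring
      rw [integral_congr_ae (hPF.mono hexp), integral_congr_ae (hQF.mono hexp),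
        integral_const_mul, integral_const_mul, hembed f hfF]
end
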